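/- Let f : ℝ × ℝ^N → ℝ^N be Lipschitz Carathéodory and satisfy (A1): for every x ∈ ℝ^N with x ≥ 0 componentwise and x_i = 0 for some index i, one has f_i(t, x) ≥ 0 for a.e. t ∈ ℝ. (i) Then for every t₀ ∈ ℝ and every x₀ ∈ ℝ^N with x₀ ≥ 0 componentwise, the solution x(t, f, t₀, x₀) satisfies x(t, f, t₀, x₀) ≥ 0 componentwise for every t ≥ t₀ in its maximal interval of existence. (ii) If f additionally satisfies (A2): there are A(·) = [a_{ij}(·)] : ℝ → ℝ^{N×N} with locally integrable entries and a_{ij}(t) ≥ 0 for all i ≠ j, and a locally integrable b : ℝ → ℝ^N with b(t) ≥ 0 componentwise for every t, such that f(t,x) ≤ A(t)x + b(t) componentwise for Lebesgue-a.e. (t,x) ∈ ℝ × (ℝ^N)⁺, then for every x₀ ≥ 0 the solution x(·, f, t₀, x₀) is defined on all of [t₀, ∞). -/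

import Mathlib

open MeasureTheory Set Filter Topology
open scoped RealInnerProductSpace

noncomputable section

abbrev Euc (n : ℕ) := EuclideanSpace ℝ (Fin n)

/-- A function `ℝ → ℝ` is locally integrable (w.r.t. Lebesgue measure) on every
compact interval. -/
def LocInt (m : ℝ → ℝ) : Prop := ∀ a b : ℝ, IntegrableOn m (Icc a b)

section Defs

variable {N : ℕ} {F : Type*} [NormedAddCommGroup F] [NormedSpace ℝ F]

/-- The Carathéodory conditions (C1) and (C2). -/
def IsCara (f : ℝ → Euc N → F) : Prop :=
  StronglyMeasurable (Function.uncurry f) ∧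
  ∀ K : Set (Euc N), IsCompact K → ∃ m : ℝ → ℝ, (∀ t, 0 ≤ m t) ∧ LocInt m ∧
    ∀ᵐ t : ℝ, ∀ x ∈ K, ‖f t x‖ ≤ m t

/-- A suitable set of moduli of continuity `Θ = {θ_j^{[q₁,q₂]}}`. -/
structure SuitableModuli where
  θ : ℕ → ℚ → ℚ → ℝ → ℝ
  nonneg : ∀ j q₁ q₂ s, (0:ℝ) ≤ s → 0 ≤ θ j q₁ q₂ s
  cont : ∀ j q₁ q₂, ContinuousOn (θ j q₁ q₂) (Ici 0)
  mono : ∀ j q₁ q₂, MonotoneOn (θ j q₁ q₂) (Ici 0)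
  zero : ∀ j q₁ q₂, θ j q₁ q₂ 0 = 0
  ordered : ∀ j₁ j₂ q₁ q₂ p₁ p₂, j₁ ≤ j₂ → p₁ ≤ q₁ → q₂ ≤ p₂ →
    ∀ s : ℝ, 0 ≤ s → θ j₁ q₁ q₂ s ≤ θ j₂ p₁ p₂ s

/-- `x ∈ K_j^{[q₁,q₂]}`: continuous, bounded by `j` and with modulus of continuity
`θ_j^{[q₁,q₂]}` on `[q₁,q₂]`. -/
def inK {N : ℕ} (Θ : SuitableModuli) (j : ℕ) (q₁ q₂ : ℚ) (x : ℝ → Euc N) : Prop :=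
  ContinuousOn x (Icc (q₁:ℝ) (q₂:ℝ)) ∧
  (∀ t ∈ Icc (q₁:ℝ) (q₂:ℝ), ‖x t‖ ≤ (j:ℝ)) ∧
  ∀ t ∈ Icc (q₁:ℝ) (q₂:ℝ), ∀ s ∈ Icc (q₁:ℝ) (q₂:ℝ), ‖x t - x s‖ ≤ Θ.θ j q₁ q₂ |t - s|

/-- Weak Θ-Carathéodory functions: Carathéodory conditions plus condition (W). -/
def IsWTC (Θ : SuitableModuli) (f : ℝ → Euc N → F) : Prop :=
  IsCara f ∧
  ∀ (j : ℕ) (q₁ q₂ : ℚ) (xs : ℕ → ℝ → Euc N) (x : ℝ → Euc N),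
    (∀ n, inK Θ j q₁ q₂ (xs n)) → inK Θ j q₁ q₂ x →
    TendstoUniformlyOn (fun n t => xs n t) x atTop (Icc (q₁:ℝ) (q₂:ℝ)) →
    Tendsto (fun n => ∫ t in Icc (q₁:ℝ) (q₂:ℝ), f t (xs n t)) atTop
      (𝓝 (∫ t in Icc (q₁:ℝ) (q₂:ℝ), f t (x t)))

/-- Convergence in the `σ_Θ` sense:
`sup_{x ∈ K_j^I} ‖∫_I (f_n(t,x(t)) − f(t,x(t))) dt‖ → 0` for every `j` and `I`. -/
def SigmaTendsto (Θ : SuitableModuli) (fs : ℕ → ℝ → Euc N → F) (f : ℝ → Euc N → F) : Prop :=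
  ∀ (j : ℕ) (q₁ q₂ : ℚ), ∀ ε > (0:ℝ), ∀ᶠ n in atTop, ∀ x : ℝ → Euc N, inK Θ j q₁ q₂ x →
    ‖∫ t in Icc (q₁:ℝ) (q₂:ℝ), (fs n t (x t) - f t (x t))‖ < ε

end Defs

/-- Lipschitz Carathéodory functions. -/
def IsLC {N : ℕ} (f : ℝ → Euc N → Euc N) : Prop :=
  IsCara f ∧
  ∀ K : Set (Euc N), IsCompact K → ∃ l : ℝ → ℝ, LocInt l ∧
    ∀ᵐ t : ℝ, ∀ x ∈ K, ∀ y ∈ K, ‖f t x - f t y‖ ≤ l t * ‖x - y‖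

/-- The optimal m-bound of `f` on the closed ball `B_j`. -/
def mOpt {N : ℕ} (f : ℝ → Euc N → Euc N) (j : ℕ) (t : ℝ) : ℝ :=
  sSup {v : ℝ | ∃ x : Euc N, ‖x‖ ≤ (j:ℝ) ∧ v = ‖f t x‖}

/-- The time translation `f_r(s,x) = f(s+r,x)`. -/
def timeTranslate {N : ℕ} (f : ℝ → Euc N → Euc N) (r : ℝ) : ℝ → Euc N → Euc N :=
  fun s x => f (s + r) x

/-- `x` is a solution of `ẋ = g(t,x)`, `x(0) = x₀`, defined on `[0,∞)`. -/
def IsSolOn {N : ℕ} (g : ℝ → Euc N → Euc N) (x₀ : Euc N) (x : ℝ → Euc N) : Prop :=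
  ContinuousOn x (Ici 0) ∧ ∀ t ∈ Ici (0:ℝ), x t = x₀ + ∫ s in (0:ℝ)..t, g s (x s)

/-! ### Gronwall's inequality with an integrable coefficient -/

/-- Post-composing an absolutely continuous function with a Lipschitz function preserves absolute
continuity. -/
theorem AbsolutelyContinuousOnInterval.lipschitzOnWith_comp {h φ : ℝ → ℝ} {a b : ℝ} {K : NNReal}
    {S : Set ℝ} (hφ : LipschitzOnWith K φ S) (hh : AbsolutelyContinuousOnInterval h a b)
    (hS : MapsTo h (uIcc a b) S) : AbsolutelyContinuousOnInterval (fun t => φ (h t)) a b := by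
  rw [absolutelyContinuousOnInterval_iff] at hh ⊢
  intro ε hε
  obtain ⟨δ, hδ, H⟩ := hh (ε / (K + 1)) (by positivity)
  refine ⟨δ, hδ, fun E hE hlen => ?_⟩
  have hsum := H E hE hlen
  have hmem := hE.1
  calc ∑ i ∈ Finset.range E.1, dist (φ (h (E.2 i).1)) (φ (h (E.2 i).2))
      ≤ ∑ i ∈ Finset.range E.1, (K : ℝ) * dist (h (E.2 i).1) (h (E.2 i).2) :=
        Finset.sum_le_sum fun i hi =>
          hφ.dist_le_mul _ (hS (hmem i hi).1) _ (hS (hmem i hi).2)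
    _ = K * ∑ i ∈ Finset.range E.1, dist (h (E.2 i).1) (h (E.2 i).2) := by rw [Finset.mul_sum]
    _ ≤ (K + 1) * ∑ i ∈ Finset.range E.1, dist (h (E.2 i).1) (h (E.2 i).2) := by
        gcongr
        linarith
    _ < (K + 1) * (ε / (K + 1)) := by gcongr
    _ = ε := by field_simp

theorem IntervalIntegrable.absolutelyContinuousOnInterval_exp_neg {l : ℝ → ℝ} {a b : ℝ}
    (hl : IntervalIntegrable l volume a b) :
    AbsolutelyContinuousOnInterval (fun t => Real.exp (-∫ s in a..t, l s)) a b := by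
  have hL := (hl.absolutelyContinuousOnInterval_intervalIntegral
    (c := a) left_mem_uIcc).neg
  obtain ⟨C, hC⟩ := hL.exists_bound
  have hexp : ContDiffOn ℝ 1 Real.exp (Icc (-C) C) := Real.contDiff_exp.contDiffOn
  obtain ⟨K, hK⟩ := hexp.exists_lipschitzOnWith (by decide) (convex_Icc _ _) isCompact_Icc
  exact hL.lipschitzOnWith_comp hK fun t ht => abs_le.mp (hC t ht)

/-- Gronwall's inequality in integral form, with an integrable coefficient. -/
theorem le_mul_exp_of_le_add_integral_mul {a b c : ℝ} {l u : ℝ → ℝ} (hab : a ≤ b)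
    (hl : IntegrableOn l (Icc a b)) (hl0 : ∀ t, 0 ≤ l t)
    (hlu : IntegrableOn (fun s => l s * u s) (Icc a b))
    (h : ∀ t ∈ Icc a b, u t ≤ c + ∫ s in a..t, l s * u s) :
    u b ≤ c * Real.exp (∫ s in a..b, l s) := by
  have hl' : IntervalIntegrable l volume a b :=
    (intervalIntegrable_iff_integrableOn_Icc_of_le hab).2 hl
  have hlu' : IntervalIntegrable (fun s => l s * u s) volume a b :=
    (intervalIntegrable_iff_integrableOn_Icc_of_le hab).2 hlu
  set w : ℝ → ℝ := fun t => c + ∫ s in a..t, l s * u s with hw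
  set e : ℝ → ℝ := fun t => Real.exp (-∫ s in a..t, l s) with he
  have hwac : AbsolutelyContinuousOnInterval w a b :=
    (LipschitzWith.const c).lipschitzOnWith.absolutelyContinuousOnInterval.add
      (hlu'.absolutelyContinuousOnInterval_intervalIntegral (c := a) left_mem_uIcc)
  have heac : AbsolutelyContinuousOnInterval e a b :=
    hl'.absolutelyContinuousOnInterval_exp_neg
  have key := hwac.integral_deriv_mul_eq_sub heac
  have hle : ∫ t in a..b, deriv w t * e t + w t * deriv e t ≤ 0 := by
    rw [intervalIntegral.integral_of_le hab]
    refine integral_nonpos_of_ae ?_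
    refine (ae_restrict_iff' measurableSet_Ioc).2 ?_
    filter_upwards [hl'.ae_hasDerivAt_integral, hlu'.ae_hasDerivAt_integral] with t h1 h2 ht
    have ht' : t ∈ Icc a b := Ioc_subset_Icc_self ht
    have htu : t ∈ uIcc a b := by rwa [uIcc_of_le hab]
    have d1 : HasDerivAt w (l t * u t) t := (h2 htu a left_mem_uIcc).const_add c
    have d2 : HasDerivAt e (Real.exp (-∫ s in a..t, l s) * -l t) t :=
      (h1 htu a left_mem_uIcc).neg.exp
    rw [d1.deriv, d2.deriv]
    have hut : u t ≤ w t := h t ht'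
    have hpos : 0 ≤ l t * Real.exp (-∫ s in a..t, l s) := mul_nonneg (hl0 t) (Real.exp_pos _).le
    simp only [he, Pi.zero_apply]
    nlinarith
  have hwb : w b * e b ≤ c := by
    have : w a * e a = c := by simp [hw, he]
    linarith
  have hub : u b ≤ w b := h b ⟨hab, le_rfl⟩
  have hmul : e b * Real.exp (∫ s in a..b, l s) = 1 := by
    simp [he, ← Real.exp_add]
  calc u b ≤ w b := hub
    _ = w b * e b * Real.exp (∫ s in a..b, l s) := by rw [mul_assoc, hmul, mul_one]
    _ ≤ c * Real.exp (∫ s in a..b, l s) := by gcongr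

/-! ### Nonnegativity of absolutely continuous families -/

/-- A family of primitives `x i` starting nonnegative stays nonnegative if, whenever a component is
negative, its derivative is bounded below by a multiple of the total negative part. -/
theorem nonneg_of_integral_of_quasipositive {ι : Type*} [Fintype ι] {t₀ T : ℝ} {l : ℝ → ℝ}
    {x v : ℝ → ι → ℝ} {x₀ : ι → ℝ} (hT : t₀ ≤ T) (hx₀ : ∀ i, 0 ≤ x₀ i)
    (hx : ∀ i, ContinuousOn (fun t => x t i) (Icc t₀ T))
    (hv : ∀ i, IntegrableOn (fun t => v t i) (Icc t₀ T))
    (hxv : ∀ t ∈ Icc t₀ T, ∀ i, x t i = x₀ i + ∫ s in t₀..t, v s i)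
    (hl : IntegrableOn l (Icc t₀ T)) (hl0 : ∀ t, 0 ≤ l t)
    (hq : ∀ᵐ t, t ∈ Icc t₀ T → ∀ i, x t i < 0 → -(l t * ∑ k, max 0 (-x t k)) ≤ v t i) :
    ∀ i, 0 ≤ x T i := by
  set V : ℝ → ℝ := fun t => ∑ k, max 0 (-x t k)
  have hVc : ContinuousOn V (Icc t₀ T) :=
    continuousOn_finsetSum _ fun k _ => continuousOn_const.sup (hx k).neg
  have hV0 : ∀ t, 0 ≤ V t := fun t => Finset.sum_nonneg fun k _ => le_max_left _ _
  have hlV : IntegrableOn (fun t => l t * V t) (Icc t₀ T) :=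
    hl.mul_continuousOn hVc isCompact_Icc
  have hii : ∀ {w : ℝ → ℝ}, IntegrableOn w (Icc t₀ T) → ∀ s ∈ Icc t₀ T, ∀ t ∈ Icc t₀ T,
      IntervalIntegrable w volume s t := fun hw s hs t ht =>
    (hw.mono_set (uIcc_subset_Icc hs ht)).intervalIntegrable
  have ht₀ : t₀ ∈ Icc t₀ T := ⟨le_rfl, hT⟩
  have hneg : ∀ t ∈ Icc t₀ T, ∀ i, max 0 (-x t i) ≤ ∫ s in t₀..t, l s * V s := by
    intro t ht i
    have hnn : ∀ s ≤ t, 0 ≤ ∫ r in s..t, l r * V r := fun s hs =>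
      intervalIntegral.integral_nonneg hs fun r _ => mul_nonneg (hl0 r) (hV0 r)
    refine max_le (hnn _ ht.1) ?_
    by_cases hxt : 0 ≤ x t i
    · linarith [hnn _ ht.1]
    push Not at hxt
    have hsub : Icc t₀ t ⊆ Icc t₀ T := Icc_subset_Icc_right ht.2
    have hcl : IsCompact (Icc t₀ t ∩ (fun s => x s i) ⁻¹' Ici 0) :=
      isCompact_Icc.of_isClosed_subset
        (((hx i).mono hsub).preimage_isClosed_of_isClosed isClosed_Icc isClosed_Ici)
        inter_subset_left
    have hx_init : x t₀ i = x₀ i := by simpa using hxv t₀ ht₀ i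
    obtain ⟨s, ⟨hst, hxs⟩, hmax⟩ := hcl.exists_isGreatest
      ⟨t₀, ⟨le_rfl, ht.1⟩, by simpa [hx_init] using hx₀ i⟩
    have hxs : 0 ≤ x s i := hxs
    have hs := hsub hst
    have hsplit : x t i = x s i + ∫ r in s..t, v r i := by
      rw [hxv t ht i, hxv s hs i, add_assoc, intervalIntegral.integral_add_adjacent_intervals
        (hii (hv i) _ ht₀ _ hs) (hii (hv i) _ hs _ ht)]
    have hlow : ∫ r in s..t, -(l r * V r) ≤ ∫ r in s..t, v r i := by
      rw [intervalIntegral.integral_of_le hst.2, intervalIntegral.integral_of_le hst.2]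
      refine setIntegral_mono_on_ae (hii hlV.neg _ hs _ ht).1 (hii (hv i) _ hs _ ht).1
        measurableSet_Ioc ?_
      filter_upwards [hq] with r hr hrst
      refine hr ⟨hs.1.trans hrst.1.le, hrst.2.trans ht.2⟩ i ?_
      by_contra! hcon
      exact absurd (hmax ⟨⟨hst.1.trans hrst.1.le, hrst.2⟩, hcon⟩) (not_le.2 hrst.1)
    have hadj := intervalIntegral.integral_add_adjacent_intervals
      (hii hlV _ ht₀ _ hs) (hii hlV _ hs _ ht)
    have hfirst : 0 ≤ ∫ r in t₀..s, l r * V r :=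
      intervalIntegral.integral_nonneg hst.1 fun r _ => mul_nonneg (hl0 r) (hV0 r)
    rw [intervalIntegral.integral_neg] at hlow
    linarith
  have hVT : V T ≤ 0 := by
    have := le_mul_exp_of_le_add_integral_mul (c := 0) (u := V)
      (l := fun t => (Fintype.card ι : ℝ) * l t) hT (hl.const_mul _)
      (fun t => mul_nonneg (Nat.cast_nonneg _) (hl0 t))
      (by simp only [mul_assoc]; exact hlV.const_mul _) fun t ht => by
        simp only [mul_assoc, intervalIntegral.integral_const_mul, zero_add]
        calc V t ≤ ∑ _k : ι, ∫ s in t₀..t, l s * V s :=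
              Finset.sum_le_sum fun k _ => hneg t ht k
          _ = _ := by simp
    simpa using this
  intro i
  have hle : max 0 (-x T i) ≤ V T :=
    Finset.single_le_sum (f := fun k => max 0 (-x T k)) (fun k _ => le_max_left _ _)
      (Finset.mem_univ i)
  linarith [le_max_right 0 (-x T i)]

/-! ### Carathéodory equations with an integrable Lipschitz coefficient -/

theorem continuousOn_Ici_of_forall_Icc {E : Type*} [TopologicalSpace E] {t₀ : ℝ} {x : ℝ → E}
    (h : ∀ T, ContinuousOn x (Icc t₀ T)) : ContinuousOn x (Ici t₀) := by
  intro t ht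
  have := h (t + 1) t ⟨ht, by linarith⟩
  refine this.mono_of_mem_nhdsWithin ?_
  rw [← Ici_inter_Iic]
  exact inter_mem self_mem_nhdsWithin (mem_nhdsWithin_of_mem_nhds (Iic_mem_nhds (by linarith)))

section Existence

variable {N : ℕ} {g : ℝ → Euc N → Euc N} {t₀ : ℝ}

theorem integrableOn_comp_of_norm_le {y : ℝ → Euc N} {m : ℝ → ℝ} {s : Set ℝ}
    (hg : StronglyMeasurable (Function.uncurry g))
    (hy : AEStronglyMeasurable y (volume.restrict s)) (hm : IntegrableOn m s)
    (hb : ∀ᵐ t ∂volume.restrict s, ‖g t (y t)‖ ≤ m t) :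
    IntegrableOn (fun t => g t (y t)) s := by
  refine Integrable.mono' hm ?_ hb
  exact (hg.measurable.comp_aemeasurable
    (aemeasurable_id.prodMk hy.aemeasurable)).aestronglyMeasurable

/-- The Picard iterates of `ẋ = g(t,x)`, `x(t₀) = x₀`. -/
def picardIterate (g : ℝ → Euc N → Euc N) (t₀ : ℝ) (x₀ : Euc N) : ℕ → ℝ → Euc N
  | 0 => fun _ => x₀
  | n + 1 => fun t => x₀ + ∫ s in t₀..t, g s (picardIterate g t₀ x₀ n s)

theorem continuousOn_const_add_integral {E : Type*} [NormedAddCommGroup E] [NormedSpace ℝ E]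
    {v : ℝ → E} {T : ℝ} (x₀ : E) (hv : IntegrableOn v (Icc t₀ T)) :
    ContinuousOn (fun t => x₀ + ∫ s in t₀..t, v s) (Icc t₀ T) := by
  rcases le_or_gt t₀ T with h | h
  · have := intervalIntegral.continuousOn_primitive_interval (μ := volume) (f := v) (a := t₀)
      (b := T) (by rwa [uIcc_of_le h])
    rw [uIcc_of_le h] at this
    exact continuousOn_const.add this
  · simp [Icc_eq_empty (not_le.2 h)]

/-- Global existence for a Carathéodory equation whose right-hand side is, on each compact time
interval, integrably bounded and Lipschitz with an integrable coefficient. -/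
theorem exists_forward_solution (hg : StronglyMeasurable (Function.uncurry g))
    (h : ∀ T, ∃ m l : ℝ → ℝ, IntegrableOn m (Icc t₀ T) ∧ IntegrableOn l (Icc t₀ T) ∧
      (∀ t, 0 ≤ l t) ∧ ∀ᵐ t, t ∈ Icc t₀ T →
        (∀ y, ‖g t y‖ ≤ m t) ∧ ∀ y z, ‖g t y - g t z‖ ≤ l t * ‖y - z‖)
    (x₀ : Euc N) :
    ∃ x : ℝ → Euc N, ContinuousOn x (Ici t₀) ∧
      ∀ t ∈ Ici t₀, x t = x₀ + ∫ s in t₀..t, g s (x s) := by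
  have hint : ∀ (y : ℝ → Euc N) (T : ℝ), AEStronglyMeasurable y (volume.restrict (Icc t₀ T)) →
      IntegrableOn (fun s => g s (y s)) (Icc t₀ T) := by
    intro y T hy
    obtain ⟨m, l, hm, hl, hl0, hml⟩ := h T
    refine integrableOn_comp_of_norm_le hg hy hm ?_
    exact (ae_restrict_iff' measurableSet_Icc).2 (hml.mono fun t ht hmem => (ht hmem).1 _)
  set X := picardIterate g t₀ x₀
  have hXs : ∀ n t, X (n + 1) t = x₀ + ∫ s in t₀..t, g s (X n s) := fun n t => rfl
  have hXc : ∀ n T, ContinuousOn (X n) (Icc t₀ T) := by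
    intro n
    induction n with
    | zero => exact fun T => continuousOn_const
    | succ n ih =>
      exact fun T => continuousOn_const_add_integral x₀
        (hint _ T ((ih T).aestronglyMeasurable measurableSet_Icc))
  have hXi : ∀ n T, IntegrableOn (fun s => g s (X n s)) (Icc t₀ T) := fun n T =>
    hint _ T ((hXc n T).aestronglyMeasurable measurableSet_Icc)
  have hii : ∀ {E : Type} [NormedAddCommGroup E] {w : ℝ → E} {T : ℝ}, IntegrableOn w (Icc t₀ T) →
      ∀ t ∈ Icc t₀ T, IntervalIntegrable w volume t₀ t := fun hw t ht =>
    (intervalIntegrable_iff_integrableOn_Icc_of_le ht.1).2 (hw.mono_set (Icc_subset_Icc_right ht.2))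
  have hconv : ∀ T ∈ Ici t₀, ∃ y, Tendsto (fun n => X n T) atTop (𝓝 y) := by
    intro T hT
    obtain ⟨m, l, hm, hl, hl0, hml⟩ := h T
    set u : ℕ → ℝ → ℝ := fun n t => ‖X (n + 1) t - X n t‖ with hu
    have huc : ∀ n, ContinuousOn (u n) (Icc t₀ T) := fun n => ((hXc _ T).sub (hXc _ T)).norm
    have hlu : ∀ n, IntegrableOn (fun s => l s * u n s) (Icc t₀ T) := fun n =>
      hl.mul_continuousOn (huc n) isCompact_Icc
    obtain ⟨M, hM⟩ := isCompact_Icc.exists_bound_of_continuousOn (huc 0)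
    have hstep : ∀ n, ∀ t ∈ Icc t₀ T, u (n + 1) t ≤ ∫ s in t₀..t, l s * u n s := by
      intro n t ht
      have hdiff : X (n + 1 + 1) t - X (n + 1) t
          = ∫ s in t₀..t, (g s (X (n + 1) s) - g s (X n s)) := by
        rw [hXs (n + 1), hXs n, intervalIntegral.integral_sub (hii (hXi _ T) t ht)
          (hii (hXi _ T) t ht)]
        abel
      simp only [hu, hdiff]
      refine intervalIntegral.norm_integral_le_of_norm_le ht.1 ?_ (hii (hlu n) t ht)
      filter_upwards [hml] with s hs hst
      exact (hs ⟨hst.1.le, hst.2.trans ht.2⟩).2 _ _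
    have hsum : ∀ n, ∑ k ∈ Finset.range n, u k T ≤ M * Real.exp (∫ s in t₀..T, l s) := by
      intro n
      refine le_mul_exp_of_le_add_integral_mul (u := fun t => ∑ k ∈ Finset.range n, u k t)
        hT hl hl0 (hl.mul_continuousOn (continuousOn_finsetSum _ fun k _ => huc k) isCompact_Icc) ?_
      intro t ht
      have hM0 : u 0 t ≤ M := (le_abs_self _).trans (hM t ht)
      have hM' : 0 ≤ M := (norm_nonneg _).trans hM0
      have hpos : ∀ k, 0 ≤ ∫ s in t₀..t, l s * u k s := fun k =>
        intervalIntegral.integral_nonneg ht.1 fun s _ => mul_nonneg (hl0 s) (norm_nonneg _)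
      simp only [Finset.mul_sum]
      rw [intervalIntegral.integral_finsetSum fun k _ => hii (hlu k) t ht]
      cases n with
      | zero => simpa using hM'
      | succ n =>
        rw [Finset.sum_range_succ', Finset.sum_range_succ]
        have := Finset.sum_le_sum fun k (_ : k ∈ Finset.range n) => hstep k t ht
        linarith [hpos n]
    have hsummable : Summable fun k => u k T :=
      summable_of_sum_range_le (fun k => norm_nonneg _) hsum
    refine cauchySeq_tendsto_of_complete (cauchySeq_of_summable_dist ?_)
    simpa only [dist_eq_norm, hu, norm_sub_rev] using hsummable
  choose! x hx using hconv
  have hxm : ∀ T, AEStronglyMeasurable x (volume.restrict (Icc t₀ T)) := fun T =>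
    aestronglyMeasurable_of_tendsto_ae atTop
      (fun n => (hXc n T).aestronglyMeasurable measurableSet_Icc)
      ((ae_restrict_iff' measurableSet_Icc).2 (Eventually.of_forall fun t ht => hx t ht.1))
  have heq : ∀ t ∈ Ici t₀, x t = x₀ + ∫ s in t₀..t, g s (x s) := by
    intro T hT
    have hT' : T ∈ Icc t₀ T := ⟨hT, le_rfl⟩
    obtain ⟨m, l, hm, hl, hl0, hml⟩ := h T
    refine tendsto_nhds_unique ((tendsto_add_atTop_iff_nat 1).2 (hx T hT)) ?_
    simp only [hXs]
    refine tendsto_const_nhds.add ?_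
    refine intervalIntegral.tendsto_integral_filter_of_dominated_convergence m
      (Eventually.of_forall fun n => ?_) (Eventually.of_forall fun n => ?_) (hii hm T hT') ?_
    · rw [uIoc_of_le hT]
      exact ((hXi n T).mono_set Ioc_subset_Icc_self).aestronglyMeasurable
    · rw [uIoc_of_le hT]
      exact hml.mono fun s hs hst => (hs (Ioc_subset_Icc_self hst)).1 _
    · rw [uIoc_of_le hT]
      filter_upwards [hml] with s hs hst
      rw [tendsto_iff_norm_sub_tendsto_zero]
      have hlim : Tendsto (fun n => l s * ‖X n s - x s‖) atTop (𝓝 0) := by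
        simpa using (tendsto_iff_norm_sub_tendsto_zero.1 (hx s hst.1.le)).const_mul (l s)
      exact squeeze_zero (fun _ => norm_nonneg _)
        (fun n => (hs (Ioc_subset_Icc_self hst)).2 _ _) hlim
  refine ⟨x, continuousOn_Ici_of_forall_Icc fun T => ?_, heq⟩
  exact (continuousOn_const_add_integral x₀ (hint x T (hxm T))).congr fun t ht => heq t ht.1

theorem eq_add_integral_apply {x v : ℝ → Euc N} {x₀ : Euc N} {t : ℝ} (ht : t₀ ≤ t)
    (hv : IntegrableOn v (Icc t₀ t)) (h : x t = x₀ + ∫ s in t₀..t, v s) (i : Fin N) :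
    x t i = x₀ i + ∫ s in t₀..t, v s i := by
  have := (EuclideanSpace.proj (𝕜 := ℝ) i).intervalIntegral_comp_comm
    ((intervalIntegrable_iff_integrableOn_Icc_of_le ht).2 hv)
  simp only [EuclideanSpace.coe_proj] at this
  rw [h, PiLp.add_apply, this]

end Existence

/-! ### Lipschitz Carathéodory functions for almost every time -/

section LipschitzCaratheodory

variable {N : ℕ} {f : ℝ → Euc N → Euc N}

theorem LocInt.intervalIntegrable {m : ℝ → ℝ} (hm : LocInt m) (a b : ℝ) :
    IntervalIntegrable m volume a b :=
  ((hm (min a b) (max a b)).mono_set subset_rfl).intervalIntegrable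

theorem LocInt.abs {m : ℝ → ℝ} (hm : LocInt m) : LocInt fun t => |m t| := fun a b => (hm a b).abs

theorem LocInt.sum {ι : Type*} {s : Finset ι} {m : ι → ℝ → ℝ} (hm : ∀ i, LocInt (m i)) :
    LocInt fun t => ∑ i ∈ s, m i t := fun a b => integrable_finsetSum _ fun i _ => hm i a b

theorem IsLC.exists_bounds (hf : IsLC f) {K : Set (Euc N)} (hK : IsCompact K) :
    ∃ m l : ℝ → ℝ, LocInt m ∧ LocInt l ∧ (∀ t, 0 ≤ l t) ∧
      ∀ᵐ t, (∀ y ∈ K, ‖f t y‖ ≤ m t) ∧ ∀ y ∈ K, ∀ z ∈ K, ‖f t y - f t z‖ ≤ l t * ‖y - z‖ := by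
  obtain ⟨m, -, hm, hmb⟩ := hf.1.2 K hK
  obtain ⟨l, hl, hlb⟩ := hf.2 K hK
  refine ⟨m, fun t => |l t|, hm, hl.abs, fun t => abs_nonneg _, ?_⟩
  filter_upwards [hmb, hlb] with t h1 h2
  refine ⟨h1, fun y hy z hz => (h2 y hy z hz).trans ?_⟩
  gcongr
  exact le_abs_self _

theorem IsLC.ae_continuous (hf : IsLC f) : ∀ᵐ t, Continuous (f t) := by
  choose m l _ _ hl0 hml using fun n : ℕ =>
    hf.exists_bounds (isCompact_closedBall (0 : Euc N) (n : ℝ))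
  filter_upwards [ae_all_iff.2 hml] with t ht
  refine continuous_iff_continuousAt.2 fun y => ?_
  obtain ⟨n, hn⟩ := exists_nat_gt ‖y‖
  have hlip : LipschitzOnWith (l n t).toNNReal (f t) (Metric.closedBall 0 n) :=
    LipschitzOnWith.of_dist_le_mul fun y hy z hz => by
      rw [dist_eq_norm, dist_eq_norm, Real.coe_toNNReal _ (hl0 n t)]
      exact (ht n).2 y hy z hz
  exact hlip.continuousOn.continuousAt (Metric.closedBall_mem_nhds_of_mem (by simpa using hn))

/-- The exceptional null set in the quasi-positivity condition can be taken independent of the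
point. -/
theorem IsLC.ae_quasipositive (hf : IsLC f)
    (hA1 : ∀ x : Euc N, (∀ i, 0 ≤ x i) → ∀ i : Fin N, x i = 0 → ∀ᵐ t : ℝ, 0 ≤ f t x i) :
    ∀ᵐ t, ∀ y : Euc N, (∀ j, 0 ≤ y j) → ∀ i, y i = 0 → 0 ≤ f t y i := by
  have hface : ∀ i, ∀ᵐ t, ∀ y : Euc N, (∀ j, 0 ≤ y j) → y i = 0 → 0 ≤ f t y i := by
    intro i
    obtain ⟨D, hDs, hDc, hD⟩ := (TopologicalSpace.IsSeparable.of_separableSpace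
      {y : Euc N | (∀ j, 0 ≤ y j) ∧ y i = 0}).exists_countable_dense_subset
    have hDae : ∀ᵐ t, ∀ y ∈ D, 0 ≤ f t y i :=
      (ae_ball_iff hDc).2 fun y hy => hA1 y (hDs hy).1 i (hDs hy).2
    filter_upwards [hDae, hf.ae_continuous] with t ht hc y hy hyi
    have hcl : IsClosed {z : Euc N | 0 ≤ f t z i} := isClosed_le continuous_const (by fun_prop)
    exact closure_minimal ht hcl (hD ⟨hy, hyi⟩)
  filter_upwards [ae_all_iff.2 hface] with t ht y hy i hyi using ht i y hy hyi

/-- A closed condition holding almost everywhere on the nonnegative cone holds on the whole cone. -/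
theorem forall_nonneg_of_ae_of_isClosed {S : Set (Euc N)} (hS : IsClosed S)
    (h : ∀ᵐ y : Euc N, (∀ i, 0 ≤ y i) → y ∈ S) {y : Euc N} (hy : ∀ i, 0 ≤ y i) : y ∈ S := by
  have hopen : IsOpen {z : Euc N | ∀ i, 0 < z i} := by
    simp only [ofPred_forall]
    exact isOpen_iInter_of_finite fun i => isOpen_lt continuous_const (by fun_prop)
  have hpos : {z : Euc N | ∀ i, 0 < z i} ⊆ S :=
    (Measure.dense_of_ae h).open_subset_closure_inter hopen |>.trans <|
      closure_minimal (fun z hz => hz.2 fun i => (hz.1 i).le) hS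
  have hlim : Tendsto (fun n : ℕ => y + (1 / ((n : ℝ) + 1)) • WithLp.toLp 2 (fun _ => (1 : ℝ)))
      atTop (𝓝 y) := by
    have hzero : Tendsto (fun n : ℕ => 1 / ((n : ℝ) + 1)) atTop (𝓝 0) :=
      tendsto_one_div_add_atTop_nhds_zero_nat
    have := tendsto_const_nhds (x := y) |>.add
      (hzero.smul_const (WithLp.toLp 2 (fun _ => (1 : ℝ)) : Euc N))
    rwa [zero_smul, add_zero] at this
  refine hS.mem_of_tendsto hlim (Eventually.of_forall fun n => hpos fun i => ?_)
  have : (0 : ℝ) < 1 / ((n : ℝ) + 1) := by positivity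
  simpa using add_pos_of_nonneg_of_pos (hy i) (by simpa using this)

theorem IsLC.ae_le_affine (hf : IsLC f) {A : ℝ → Matrix (Fin N) (Fin N) ℝ} {b : ℝ → Euc N}
    (h : ∀ᵐ p : ℝ × Euc N, (∀ i, 0 ≤ p.2 i) →
        ∀ i : Fin N, f p.1 p.2 i ≤ (∑ k, A p.1 i k * p.2 k) + b p.1 i) :
    ∀ᵐ t, ∀ y : Euc N, (∀ i, 0 ≤ y i) → ∀ i, f t y i ≤ (∑ k, A t i k * y k) + b t i := by
  filter_upwards [Measure.ae_ae_of_ae_prod h, hf.ae_continuous] with t ht hc y hy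
  have hS : IsClosed {y : Euc N | ∀ i, f t y i ≤ (∑ k, A t i k * y k) + b t i} := by
    simp only [ofPred_forall]
    exact isClosed_iInter fun i => isClosed_le (by fun_prop) (by fun_prop)
  exact forall_nonneg_of_ae_of_isClosed hS ht hy

/-! ### Truncation to boxes -/

/-- The projection of `y` onto the box `[0, R]^N`. -/
def boxClamp (R : ℝ) (y : Euc N) : Euc N := WithLp.toLp 2 fun i => max 0 (min (y i) R)

theorem boxClamp_apply (R : ℝ) (y : Euc N) (i : Fin N) : boxClamp R y i = max 0 (min (y i) R) := rfl

theorem norm_boxClamp_sub_le (R : ℝ) (y z : Euc N) :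
    ‖boxClamp R y - boxClamp R z‖ ≤ ‖y - z‖ := by
  rw [EuclideanSpace.norm_eq, EuclideanSpace.norm_eq]
  gcongr with i
  simp only [PiLp.sub_apply, boxClamp_apply, Real.norm_eq_abs]
  calc |max 0 (min (y i) R) - max 0 (min (z i) R)| ≤ |min (y i) R - min (z i) R| := by
        simpa using abs_max_sub_max_le_max 0 (min (y i) R) 0 (min (z i) R)
    _ ≤ |y i - z i| := by simpa using abs_min_sub_min_le_max (y i) R (z i) R

theorem boxClamp_eq_self {R : ℝ} {y : Euc N} (h0 : ∀ i, 0 ≤ y i) (hR : ∀ i, y i ≤ R) :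
    boxClamp R y = y := by
  ext i
  rw [boxClamp_apply, min_eq_left (hR i), max_eq_right (h0 i)]

theorem isCompact_box (N : ℕ) (R : ℝ) : IsCompact {y : Euc N | ∀ i, 0 ≤ y i ∧ y i ≤ R} := by
  convert! (isCompact_Icc (a := (0 : Fin N → ℝ)) (b := fun _ => R)).image
    (PiLp.continuous_toLp 2 fun _ : Fin N => ℝ) using 1
  ext y
  constructor
  · exact fun hy => ⟨y.ofLp, ⟨fun i => (hy i).1, fun i => (hy i).2⟩, rfl⟩
  · rintro ⟨z, hz, rfl⟩ i
    exact ⟨hz.1 i, hz.2 i⟩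

theorem continuous_boxClamp : Continuous fun p : ℝ × Euc N => boxClamp p.1 p.2 := by
  unfold boxClamp
  fun_prop

/-! ### Invariance of the cone and global existence -/

theorem IsLC.nonneg_of_quasipositive (hf : IsLC f)
    (hA1 : ∀ x : Euc N, (∀ i, 0 ≤ x i) → ∀ i : Fin N, x i = 0 → ∀ᵐ t : ℝ, 0 ≤ f t x i)
    {t₀ T : ℝ} {x₀ : Euc N} (hx₀ : ∀ i, 0 ≤ x₀ i) {x : ℝ → Euc N} (hT : t₀ ≤ T)
    (hx : ContinuousOn x (Icc t₀ T))
    (hsol : ∀ t ∈ Icc t₀ T, x t = x₀ + ∫ s in t₀..t, f s (x s)) (i : Fin N) : 0 ≤ x T i := by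
  obtain ⟨M, hM⟩ := isCompact_Icc.exists_bound_of_continuousOn hx
  obtain ⟨m, l, hm, hl, hl0, hml⟩ := hf.exists_bounds (isCompact_closedBall (0 : Euc N) M)
  have hv : IntegrableOn (fun s => f s (x s)) (Icc t₀ T) := by
    refine integrableOn_comp_of_norm_le hf.1.1 (hx.aestronglyMeasurable measurableSet_Icc)
      (hm t₀ T) ((ae_restrict_iff' measurableSet_Icc).2 ?_)
    filter_upwards [hml] with t ht htm
    exact ht.1 _ (by simpa using hM t htm)
  refine nonneg_of_integral_of_quasipositive (x := fun t i => x t i) (v := fun t i => f t (x t) i)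
    (x₀ := fun i => x₀ i) hT hx₀ (fun i => ?_) (fun i => ?_) (fun t ht i => ?_) (hl t₀ T) hl0 ?_ i
  · exact (EuclideanSpace.proj (𝕜 := ℝ) i).continuous.comp_continuousOn hx
  · exact (EuclideanSpace.proj (𝕜 := ℝ) i).integrable_comp hv
  · exact eq_add_integral_apply ht.1 (hv.mono_set (Icc_subset_Icc_right ht.2)) (hsol t ht) i
  · filter_upwards [hml, hf.ae_quasipositive hA1] with t ht hq htm j hj
    set y := x t
    set z : Euc N := WithLp.toLp 2 fun k => max 0 (y k)
    have hzk : ∀ k, z k = max 0 (y k) := fun k => rfl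
    have hyM : ‖y‖ ≤ M := hM t htm
    have hzy : ‖z‖ ≤ ‖y‖ := by
      rw [EuclideanSpace.norm_eq, EuclideanSpace.norm_eq]
      gcongr with k
      rw [hzk, Real.norm_eq_abs, Real.norm_eq_abs, abs_of_nonneg (le_max_left _ _)]
      exact max_le (abs_nonneg _) (le_abs_self _)
    have hsub : ‖y - z‖ ≤ ∑ k, max 0 (-y k) := by
      calc ‖y - z‖ = √(∑ k, (max 0 (-y k)) ^ 2) := by
            rw [EuclideanSpace.norm_eq]
            congr 1
            refine Finset.sum_congr rfl fun k _ => ?_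
            rw [PiLp.sub_apply, hzk, Real.norm_eq_abs, sq_abs]
            rcases le_total 0 (y k) with h | h
            · rw [max_eq_right h, max_eq_left (by linarith)]
              ring
            · rw [max_eq_left h, max_eq_right (by linarith)]
              ring
        _ ≤ ∑ k, max 0 (-y k) := by
            refine Real.sqrt_le_iff.2 ⟨Finset.sum_nonneg fun k _ => le_max_left _ _, ?_⟩
            exact Finset.sum_sq_le_sq_sum_of_nonneg fun k _ => le_max_left _ _
    have hfz : 0 ≤ f t z j := hq z (fun k => le_max_left _ _) j (max_eq_left hj.le)
    have hdiff : |f t y j - f t z j| ≤ l t * ∑ k, max 0 (-y k) := by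
      calc |f t y j - f t z j| ≤ ‖f t y - f t z‖ := by
            simpa using PiLp.norm_apply_le (f t y - f t z) j
        _ ≤ l t * ‖y - z‖ := ht.2 y (by simpa using hyM) z (by simpa using hzy.trans hyM)
        _ ≤ l t * ∑ k, max 0 (-y k) := mul_le_mul_of_nonneg_left hsub (hl0 t)
    linarith [neg_abs_le (f t y j - f t z j)]

/-- A priori bound for the sum of primitives `x i` of `v i` when `∑ i, v i` is at most
`α * ∑ i, x i + β`. -/
theorem sum_le_mul_exp_of_integral {ι : Type*} [Fintype ι] {t₀ T : ℝ} {α β : ℝ → ℝ}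
    {x v : ℝ → ι → ℝ} {x₀ : ι → ℝ} (hT : t₀ ≤ T)
    (hx : ∀ i, ContinuousOn (fun t => x t i) (Icc t₀ T))
    (hv : ∀ i, IntegrableOn (fun t => v t i) (Icc t₀ T))
    (hxv : ∀ t ∈ Icc t₀ T, ∀ i, x t i = x₀ i + ∫ s in t₀..t, v s i)
    (hα : IntegrableOn α (Icc t₀ T)) (hα0 : ∀ t, 0 ≤ α t)
    (hβ : IntegrableOn β (Icc t₀ T)) (hβ0 : ∀ t, 0 ≤ β t)
    (hle : ∀ᵐ t, t ∈ Icc t₀ T → ∑ i, v t i ≤ α t * ∑ i, x t i + β t) :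
    ∑ i, x T i ≤ (∑ i, x₀ i + ∫ s in t₀..T, β s) * Real.exp (∫ s in t₀..T, α s) := by
  have hii : ∀ {w : ℝ → ℝ}, IntegrableOn w (Icc t₀ T) → ∀ t ∈ Icc t₀ T,
      IntervalIntegrable w volume t₀ t := fun hw t ht =>
    (intervalIntegrable_iff_integrableOn_Icc_of_le ht.1).2 (hw.mono_set (Icc_subset_Icc_right ht.2))
  have hαx : IntegrableOn (fun t => α t * ∑ i, x t i) (Icc t₀ T) :=
    hα.mul_continuousOn (continuousOn_finsetSum _ fun i _ => hx i) isCompact_Icc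
  refine le_mul_exp_of_le_add_integral_mul (u := fun t => ∑ i, x t i) hT hα hα0 hαx ?_
  intro t ht
  have hsum : ∑ i, x t i = ∑ i, x₀ i + ∫ s in t₀..t, ∑ i, v s i := by
    rw [intervalIntegral.integral_finsetSum fun i _ => hii (hv i) t ht, ← Finset.sum_add_distrib]
    exact Finset.sum_congr rfl fun i _ => hxv t ht i
  have hmono : ∫ s in t₀..t, ∑ i, v s i
      ≤ (∫ s in t₀..t, α s * ∑ i, x s i) + ∫ s in t₀..t, β s := by
    rw [← intervalIntegral.integral_add (hii hαx t ht) (hii hβ t ht),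
      intervalIntegral.integral_of_le ht.1, intervalIntegral.integral_of_le ht.1]
    refine setIntegral_mono_on_ae
      (hii (integrable_finsetSum _ fun i _ => hv i) t ht).1
      ((hii hαx t ht).add (hii hβ t ht)).1 measurableSet_Ioc ?_
    filter_upwards [hle] with s hs hst using hs ⟨hst.1.le, hst.2.trans ht.2⟩
  have hβt : ∫ s in t₀..t, β s ≤ ∫ s in t₀..T, β s :=
    intervalIntegral.integral_mono_interval le_rfl ht.1 ht.2
      (Eventually.of_forall hβ0) (hii hβ T ⟨hT, le_rfl⟩)
  linarith

theorem IsLC.exists_forward_solution_of_le_affine (hf : IsLC f)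
    (hA1 : ∀ x : Euc N, (∀ i, 0 ≤ x i) → ∀ i : Fin N, x i = 0 → ∀ᵐ t : ℝ, 0 ≤ f t x i)
    {A : ℝ → Matrix (Fin N) (Fin N) ℝ} {b : ℝ → Euc N}
    (hA : ∀ i j : Fin N, LocInt fun t => A t i j)
    (hb : ∀ i : Fin N, LocInt fun t => b t i) (hb0 : ∀ (t : ℝ) (i : Fin N), 0 ≤ b t i)
    (hle : ∀ᵐ p : ℝ × Euc N, (∀ i, 0 ≤ p.2 i) →
        ∀ i : Fin N, f p.1 p.2 i ≤ (∑ k, A p.1 i k * p.2 k) + b p.1 i)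
    (t₀ : ℝ) {x₀ : Euc N} (hx₀ : ∀ i, 0 ≤ x₀ i) :
    ∃ x : ℝ → Euc N, ContinuousOn x (Ici t₀) ∧
      ∀ t ∈ Ici t₀, x t = x₀ + ∫ s in t₀..t, f s (x s) := by
  set α : ℝ → ℝ := fun t => ∑ i, ∑ k, |A t i k| with hα
  set β : ℝ → ℝ := fun t => ∑ i, b t i with hβ
  have hαi : LocInt α := LocInt.sum fun i => LocInt.sum fun k => (hA i k).abs
  have hβi : LocInt β := LocInt.sum hb
  have hα0 : ∀ t, 0 ≤ α t := fun t =>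
    Finset.sum_nonneg fun i _ => Finset.sum_nonneg fun k _ => abs_nonneg _
  have hβ0 : ∀ t, 0 ≤ β t := fun t => Finset.sum_nonneg fun i _ => hb0 t i
  set R : ℝ → ℝ := fun t => (∑ i, x₀ i + ∫ s in t₀..t, β s) * Real.exp (∫ s in t₀..t, α s) with hR
  have hRc : Continuous R :=
    (continuous_const.add (intervalIntegral.continuous_primitive hβi.intervalIntegrable t₀)).mul
      (intervalIntegral.continuous_primitive hαi.intervalIntegrable t₀).rexp
  have hx₀sum : 0 ≤ ∑ i, x₀ i := Finset.sum_nonneg fun i _ => hx₀ i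
  have hRmono : ∀ s t, t₀ ≤ s → s ≤ t → R s ≤ R t := by
    intro s t hs hst
    have h1 : ∫ r in t₀..s, α r ≤ ∫ r in t₀..t, α r :=
      intervalIntegral.integral_mono_interval le_rfl hs hst (Eventually.of_forall hα0)
        (hαi.intervalIntegrable _ _)
    have h2 : ∫ r in t₀..s, β r ≤ ∫ r in t₀..t, β r :=
      intervalIntegral.integral_mono_interval le_rfl hs hst (Eventually.of_forall hβ0)
        (hβi.intervalIntegrable _ _)
    have h3 : 0 ≤ ∫ r in t₀..t, β r :=
      intervalIntegral.integral_nonneg (hs.trans hst) fun r _ => hβ0 r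
    simp only [hR]
    gcongr
  have hR0 : ∀ t, t₀ ≤ t → 0 ≤ R t := by
    intro t ht
    have : R t₀ = ∑ i, x₀ i := by simp [hR]
    linarith [hRmono t₀ t le_rfl ht]
  set g : ℝ → Euc N → Euc N := fun t y => f t (boxClamp (R t) y) with hg
  have hgm : StronglyMeasurable (Function.uncurry g) := by
    have hclamp : Measurable fun p : ℝ × Euc N => (p.1, boxClamp (R p.1) p.2) :=
      measurable_fst.prodMk (continuous_boxClamp.comp
        ((hRc.comp continuous_fst).prodMk continuous_snd)).measurable
    exact hf.1.1.comp_measurable hclamp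
  have hbounds : ∀ T, ∃ m l : ℝ → ℝ, IntegrableOn m (Icc t₀ T) ∧ IntegrableOn l (Icc t₀ T) ∧
      (∀ t, 0 ≤ l t) ∧ ∀ᵐ t, t ∈ Icc t₀ T →
        (∀ y, ‖g t y‖ ≤ m t) ∧ ∀ y z, ‖g t y - g t z‖ ≤ l t * ‖y - z‖ := by
    intro T
    obtain ⟨m, l, hm, hl, hl0, hml⟩ := hf.exists_bounds (isCompact_box N (R T))
    refine ⟨m, l, hm t₀ T, hl t₀ T, hl0, ?_⟩
    filter_upwards [hml] with t ht htT
    have hmem : ∀ y, boxClamp (R t) y ∈ {y : Euc N | ∀ i, 0 ≤ y i ∧ y i ≤ R T} := fun y i =>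
      ⟨le_max_left _ _, max_le (hR0 T (htT.1.trans htT.2))
        ((min_le_right _ _).trans (hRmono t T htT.1 htT.2))⟩
    exact ⟨fun y => ht.1 _ (hmem y), fun y z => (ht.2 _ (hmem y) _ (hmem z)).trans
      (mul_le_mul_of_nonneg_left (norm_boxClamp_sub_le _ _ _) (hl0 t))⟩
  obtain ⟨x, hxc, hxsol⟩ := exists_forward_solution hgm hbounds x₀
  have hxi : ∀ T, IntegrableOn (fun s => g s (x s)) (Icc t₀ T) := by
    intro T
    obtain ⟨m, l, hm, hl, hl0, hml⟩ := hbounds T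
    refine integrableOn_comp_of_norm_le hgm
      ((hxc.mono Icc_subset_Ici_self).aestronglyMeasurable measurableSet_Icc) hm
      ((ae_restrict_iff' measurableSet_Icc).2 ?_)
    exact hml.mono fun t ht htT => (ht htT).1 _
  have hcoordc : ∀ T i, ContinuousOn (fun t => x t i) (Icc t₀ T) := fun T i =>
    (EuclideanSpace.proj (𝕜 := ℝ) i).continuous.comp_continuousOn (hxc.mono Icc_subset_Ici_self)
  have hcoordi : ∀ T i, IntegrableOn (fun t => g t (x t) i) (Icc t₀ T) := fun T i =>
    (EuclideanSpace.proj (𝕜 := ℝ) i).integrable_comp (hxi T)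
  have hcoord : ∀ T, ∀ t ∈ Icc t₀ T, ∀ i, x t i = x₀ i + ∫ s in t₀..t, g s (x s) i :=
    fun T t ht i => eq_add_integral_apply ht.1 (hxi t) (hxsol t ht.1) i
  have hxnn : ∀ T ∈ Ici t₀, ∀ i, 0 ≤ x T i := by
    intro T hT
    refine nonneg_of_integral_of_quasipositive (x := fun t i => x t i) (l := fun _ => 0)
      (v := fun t i => g t (x t) i) hT hx₀ (hcoordc T) (hcoordi T) (hcoord T)
      integrableOn_zero (fun _ => le_rfl) ?_
    filter_upwards [hf.ae_quasipositive hA1] with t ht _ i hi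
    simpa using ht (boxClamp (R t) (x t)) (fun k => le_max_left _ _) i
      (max_eq_left ((min_le_left _ _).trans hi.le))
  have hxR : ∀ T ∈ Ici t₀, ∑ i, x T i ≤ R T := by
    intro T hT
    refine sum_le_mul_exp_of_integral (x := fun t i => x t i) (v := fun t i => g t (x t) i)
      (x₀ := fun i => x₀ i) hT (hcoordc T) (hcoordi T) (hcoord T) (hαi t₀ T) hα0 (hβi t₀ T) hβ0 ?_
    filter_upwards [hf.ae_le_affine hle] with t ht htT
    have hxt := hxnn t htT.1
    set z := boxClamp (R t) (x t)
    have hz0 : ∀ k, 0 ≤ z k := fun k => le_max_left _ _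
    have hzx : ∀ k, z k ≤ x t k := fun k => max_le (hxt k) (min_le_left _ _)
    have hterm : ∀ i k, A t i k * z k ≤ |A t i k| * ∑ j, x t j := fun i k =>
      mul_le_mul (le_abs_self _) ((hzx k).trans
        (Finset.single_le_sum (f := fun j => x t j) (fun j _ => hxt j) (Finset.mem_univ k)))
        (hz0 k) (abs_nonneg _)
    calc ∑ i, g t (x t) i ≤ ∑ i, ((∑ k, |A t i k| * ∑ j, x t j) + b t i) :=
          Finset.sum_le_sum fun i _ => (ht z hz0 i).trans
            (add_le_add_left (Finset.sum_le_sum fun k _ => hterm i k) _)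
      _ = α t * ∑ i, x t i + β t := by
          simp only [hα, hβ, Finset.sum_add_distrib, Finset.sum_mul]
  have hgf : ∀ t ∈ Ici t₀, g t (x t) = f t (x t) := by
    intro t ht
    simp only [hg]
    rw [boxClamp_eq_self (hxnn t ht) fun i => ?_]
    exact (Finset.single_le_sum (f := fun j => x t j) (fun j _ => hxnn t ht j)
      (Finset.mem_univ i)).trans (hxR t ht)
  refine ⟨x, hxc, fun t ht => ?_⟩
  rw [hxsol t ht]
  congr 1
  refine intervalIntegral.integral_congr fun s hs => ?_
  rw [uIcc_of_le ht] at hs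
  exact hgf s hs.1

end LipschitzCaratheodory

/-- (i) under (A1) the nonnegative cone is positively invariant for
`ẋ = f(t,x)`; (ii) under (A1) and (A2) the solutions starting in the cone are
globally defined in forward time. -/
theorem stmt19 {N : ℕ} (f : ℝ → Euc N → Euc N) (hf : IsLC f)
    (hA1 : ∀ x : Euc N, (∀ i, 0 ≤ x i) → ∀ i : Fin N, x i = 0 → ∀ᵐ t : ℝ, 0 ≤ f t x i) :
    (∀ (t₀ : ℝ) (x₀ : Euc N), (∀ i, 0 ≤ x₀ i) →
      ∀ (x : ℝ → Euc N) (T : ℝ), t₀ ≤ T → ContinuousOn x (Icc t₀ T) →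
        (∀ t ∈ Icc t₀ T, x t = x₀ + ∫ s in t₀..t, f s (x s)) →
        ∀ t ∈ Icc t₀ T, ∀ i : Fin N, 0 ≤ x t i) ∧
    (∀ (A : ℝ → Matrix (Fin N) (Fin N) ℝ) (b : ℝ → Euc N),
      (∀ i j : Fin N, LocInt fun t => A t i j) →
      (∀ t : ℝ, ∀ i j : Fin N, i ≠ j → 0 ≤ A t i j) →
      (∀ i : Fin N, LocInt fun t => b t i) →
      (∀ (t : ℝ) (i : Fin N), 0 ≤ b t i) →
      (∀ᵐ p : ℝ × Euc N, (∀ i, 0 ≤ p.2 i) →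
        ∀ i : Fin N, f p.1 p.2 i ≤ (∑ k, A p.1 i k * p.2 k) + b p.1 i) →
      ∀ (t₀ : ℝ) (x₀ : Euc N), (∀ i, 0 ≤ x₀ i) →
        ∃ x : ℝ → Euc N, ContinuousOn x (Ici t₀) ∧
          ∀ t ∈ Ici t₀, x t = x₀ + ∫ s in t₀..t, f s (x s)) := by
  refine ⟨fun t₀ x₀ hx₀ x T _ hx hsol t ht i => ?_, fun A b hA _ hb hb0 hle t₀ x₀ hx₀ =>
    hf.exists_forward_solution_of_le_affine hA1 hA hb hb0 hle t₀ hx₀⟩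
  have hsub : Icc t₀ t ⊆ Icc t₀ T := Icc_subset_Icc_right ht.2
  exact hf.nonneg_of_quasipositive hA1 hx₀ ht.1 (hx.mono hsub) (fun s hs => hsol s (hsub hs)) i
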